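/- Let X be a gamble with maximal loss L(X) = 1 whose distribution has a strictly positive density on its support (either [-1, M] or [-1, ∞)). Let (X_n) be the increasing dyadic discretizations of X with X_n → X a.s., λ_n ∈ (0,1) the unique positive solution of E[log(1 + λ_n X_n)] = 0, and λ_∞ = lim_n λ_n. If E[log(1 + X)] ≥ 0, then λ_∞ = 1 = 1/L(X). -/

import Mathlib

open MeasureTheory Filter

/-- Strict concavity of the logarithm along the segment from `1` to `1 + x`. -/
lemma mul_log_one_add_lt_log_one_add_mul {c x : ℝ} (hc0 : 0 < c) (hc1 : c < 1) (hx : -1 < x)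
    (hx0 : x ≠ 0) : c * Real.log (1 + x) < Real.log (1 + c * x) := by
  have key := strictConcaveOn_log_Ioi.2 (Set.mem_Ioi.2 one_pos)
    (Set.mem_Ioi.2 (show 0 < 1 + x by linarith)) (by simpa using hx0)
    (sub_pos.2 hc1) hc0 (sub_add_cancel 1 c)
  simp only [smul_eq_mul, Real.log_one, mul_zero, zero_add] at key
  rwa [show (1 - c) * 1 + c * (1 + x) = 1 + c * x by ring] at key

/-- A bound for `log (1 + l * y)` that is uniform over `l ∈ [0, c]` and `y ∈ [-1, x]`. -/
lemma abs_log_one_add_mul_le {c l x y : ℝ} (hc : c < 1) (hl0 : 0 ≤ l) (hlc : l ≤ c)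
    (hy : -1 ≤ y) (hyx : y ≤ x) :
    |Real.log (1 + l * y)| ≤ |x| + |Real.log (1 - c)| := by
  have hlow : 1 - c ≤ 1 + l * y := by nlinarith
  have h1 := Real.log_le_log (by linarith) hlow
  have h2 := Real.log_le_sub_one_of_pos (show 0 < 1 + l * y by linarith)
  have h3 : l * y ≤ |x| := by
    nlinarith [mul_le_mul_of_nonneg_left (hyx.trans (le_abs_self x)) hl0, abs_nonneg x]
  have h4 := neg_abs_le (Real.log (1 - c))
  have h5 := abs_nonneg (Real.log (1 - c))
  have h6 := abs_nonneg x
  exact abs_le.2 ⟨by linarith, by linarith⟩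

/-- let `X` be a gamble with maximal loss normalized to `1` (so `X ≥ −1`
a.s., and, having a density, `P(X = −1) = 0`), approximated from below by nondecreasing
finite-valued discretizations `X_n ↑ X` a.s., with Foster–Hart roots `λ_n ∈ (0,1)`
(for `n ≥ N`), `λ_n` nondecreasing with limit `λ_∞`.  If `E[log(1 + X)] ≥ 0` then
`λ_∞ = 1 = 1/L(X)`. -/
theorem fosterHart_limit_eq_maximal_loss_of_nonneg
    {Ω : Type*} [MeasurableSpace Ω] (P : Measure Ω) [IsProbabilityMeasure P]
    (X : Ω → ℝ) (hXmeas : Measurable X) (hXint : Integrable X P)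
    (hXlb : ∀ᵐ ω ∂P, -1 ≤ X ω) (hnull : P {ω | X ω = -1} = 0)
    (hEX : 0 < ∫ ω, X ω ∂P) (hXneg : 0 < P {ω | X ω < 0})
    (Xn : ℕ → Ω → ℝ) (hXnmeas : ∀ n, Measurable (Xn n))
    (hXnfin : ∀ n, (Set.range (Xn n)).Finite)
    (hmono : ∀ ω, Monotone fun n => Xn n ω)
    (hle : ∀ n ω, Xn n ω ≤ X ω) (hlb : ∀ n ω, -1 ≤ Xn n ω)
    (htend : ∀ᵐ ω ∂P, Tendsto (fun n => Xn n ω) atTop (nhds (X ω)))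
    (N : ℕ) (lam : ℕ → ℝ)
    (hlam : ∀ n, N ≤ n → lam n ∈ Set.Ioo (0 : ℝ) 1 ∧
      (∫ ω, Real.log (1 + lam n * Xn n ω) ∂P) = 0)
    (hlammono : ∀ m n, N ≤ m → m ≤ n → lam m ≤ lam n)
    (laminf : ℝ) (hlim : Tendsto lam atTop (nhds laminf))
    (hint : Integrable (fun ω => Real.log (1 + X ω)) P)
    (h : 0 ≤ ∫ ω, Real.log (1 + X ω) ∂P) :
    laminf = 1 := by
  have hge : ∀ n, N ≤ n → lam n ≤ laminf := fun n hn =>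
    ge_of_tendsto hlim (eventually_atTop.2 ⟨n, fun m hm => hlammono n m hn hm⟩)
  have hpos : 0 < laminf := (hlam N le_rfl).1.1.trans_le (hge N le_rfl)
  have hle1 : laminf ≤ 1 :=
    le_of_tendsto hlim (eventually_atTop.2 ⟨N, fun n hn => (hlam n hn).1.2.le⟩)
  by_contra hne
  have hlt : laminf < 1 := lt_of_le_of_ne hle1 hne
  have hXgt : ∀ᵐ ω ∂P, -1 < X ω := by
    have hX : ∀ᵐ ω ∂P, X ω ≠ -1 := by
      rw [ae_iff]
      simpa using hnull
    filter_upwards [hXlb, hX] with ω h1 h2 using lt_of_le_of_ne h1 h2.symm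
  have hbound : Integrable (fun ω => |X ω| + |Real.log (1 - laminf)|) P :=
    hXint.abs.add (integrable_const _)
  have hzero : ∫ ω, Real.log (1 + laminf * X ω) ∂P = 0 := by
    refine tendsto_nhds_unique
      (tendsto_integral_filter_of_dominated_convergence (μ := P) (l := atTop)
        (F := fun n ω => Real.log (1 + lam n * Xn n ω))
        (fun ω => |X ω| + |Real.log (1 - laminf)|) ?_ ?_ hbound ?_) ?_
    · exact Eventually.of_forall fun n =>
        (Real.measurable_log.comp
          (((hXnmeas n).const_mul (lam n)).const_add 1)).aestronglyMeasurable
    · filter_upwards [eventually_ge_atTop N] with n hn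
      exact Eventually.of_forall fun ω =>
        abs_log_one_add_mul_le hlt (hlam n hn).1.1.le (hge n hn) (hlb n ω) (hle n ω)
    · filter_upwards [htend, hXlb] with ω hω h1
      exact ((hlim.mul hω).const_add 1).log (by nlinarith)
    · refine tendsto_const_nhds.congr' ?_
      filter_upwards [eventually_ge_atTop N] with n hn using (hlam n hn).2.symm
  have hintc : Integrable (fun ω => Real.log (1 + laminf * X ω)) P := by
    refine hbound.mono' (Real.measurable_log.comp
      ((hXmeas.const_mul laminf).const_add 1)).aestronglyMeasurable ?_
    filter_upwards [hXlb] with ω h1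
    exact abs_log_one_add_mul_le hlt hpos.le le_rfl h1 le_rfl
  have hgap : ∀ᵐ ω ∂P,
      0 ≤ Real.log (1 + laminf * X ω) - laminf * Real.log (1 + X ω) := by
    filter_upwards [hXgt] with ω h1
    rcases eq_or_ne (X ω) 0 with h0 | h0
    · simp [h0]
    · exact (sub_pos.2 (mul_log_one_add_lt_log_one_add_mul hpos hlt h1 h0)).le
  have hgapint := hintc.sub (hint.const_mul laminf)
  have hgapzero :
      ∫ ω, (Real.log (1 + laminf * X ω) - laminf * Real.log (1 + X ω)) ∂P = 0 := by
    refine le_antisymm ?_ (integral_nonneg_of_ae hgap)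
    rw [integral_sub hintc (hint.const_mul laminf), hzero, integral_const_mul]
    linarith [mul_nonneg hpos.le h]
  have hX0 : ∀ᵐ ω ∂P, X ω = 0 := by
    filter_upwards [(integral_eq_zero_iff_of_nonneg_ae hgap hgapint).1 hgapzero, hXgt]
      with ω h1 h2
    by_contra h0
    exact (sub_pos.2 (mul_log_one_add_lt_log_one_add_mul hpos hlt h2 h0)).ne' h1
  exact hEX.ne' (integral_eq_zero_of_ae hX0)
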